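/- Integration by parts for the truncation φ: let h: ℝᵐ → ℝ be smooth of moderate growth and B, G_1, …, G_m jointly Gaussian centered with E[B²] = σ², σ ∈ (0,1]. Then E[φ(B)·h(G)] = ∑_{i=1}^m E[B·G_i]·E[Ψ_σ(B)·∂h/∂x_i(G)], where φ(s) = Φ(s) − 1/2 and Ψ_σ(s) = (1/√(2π))∫_0^1 e^{-s²y²/2}/(1+σ²y²) dy. -/

import Mathlib

open MeasureTheory ProbabilityTheory

noncomputable def gauss (s : ℝ) : ℝ := (Real.sqrt (2 * Real.pi))⁻¹ * Real.exp (-s ^ 2 / 2)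

noncomputable def PhiCDF (a : ℝ) : ℝ := ∫ t in Set.Iic a, gauss t

noncomputable def phiTr (s : ℝ) : ℝ := PhiCDF s - 1 / 2

noncomputable def PsiFn (σ s : ℝ) : ℝ :=
  (Real.sqrt (2 * Real.pi))⁻¹ * ∫ y in (0:ℝ)..1, Real.exp (-s ^ 2 * y ^ 2 / 2) / (1 + σ ^ 2 * y ^ 2)

lemma gauss_eq_gaussianPDFReal : gauss = gaussianPDFReal 0 1 := by
  ext s
  simp [gauss, gaussianPDFReal]

lemma integrable_gauss : Integrable gauss :=
  gauss_eq_gaussianPDFReal ▸ integrable_gaussianPDFReal 0 1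

lemma gauss_nonneg (s : ℝ) : 0 ≤ gauss s := by
  unfold gauss
  positivity

lemma integral_gauss : ∫ t, gauss t = 1 := by
  rw [gauss_eq_gaussianPDFReal]
  exact integral_gaussianPDFReal_eq_one 0 one_ne_zero

lemma PhiCDF_nonneg (s : ℝ) : 0 ≤ PhiCDF s :=
  integral_nonneg gauss_nonneg

lemma PhiCDF_le_one (s : ℝ) : PhiCDF s ≤ 1 :=
  integral_gauss ▸ setIntegral_le_integral integrable_gauss (.of_forall gauss_nonneg)

lemma monotone_PhiCDF : Monotone PhiCDF := fun _ _ hab =>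
  setIntegral_mono_set integrable_gauss.integrableOn (.of_forall gauss_nonneg)
    (Set.Iic_subset_Iic.2 hab).eventuallyLE

lemma PhiCDF_zero : PhiCDF 0 = 1 / 2 := by
  have hsymm : ∫ t in Set.Ioi 0, gauss t = PhiCDF 0 := by
    have := integral_comp_neg_Iic (0 : ℝ) gauss
    rw [neg_zero] at this
    rw [← this, PhiCDF]
    simp [gauss]
  have hsum := intervalIntegral.integral_Iic_add_Ioi (b := (0 : ℝ))
    integrable_gauss.integrableOn integrable_gauss.integrableOn
  rw [hsymm, integral_gauss] at hsum
  change PhiCDF 0 + PhiCDF 0 = 1 at hsum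
  linarith

lemma measurable_phiTr : Measurable phiTr :=
  monotone_PhiCDF.measurable.sub_const _

lemma abs_phiTr_le (s : ℝ) : |phiTr s| ≤ 1 := by
  rw [abs_le, phiTr]
  constructor <;> linarith [PhiCDF_nonneg s, PhiCDF_le_one s]

lemma phiTr_eq_integral (s : ℝ) :
    phiTr s = (Real.sqrt (2 * Real.pi))⁻¹ *
      ∫ y in (0:ℝ)..1, s * Real.exp (-s ^ 2 * y ^ 2 / 2) := by
  have hdiff := intervalIntegral.integral_Iic_sub_Iic (a := 0) (b := s)
    integrable_gauss.integrableOn integrable_gauss.integrableOn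
  change PhiCDF s - PhiCDF 0 = _ at hdiff
  have hscale := intervalIntegral.mul_integral_comp_mul_left (a := 0) (b := 1) (f := gauss) s
  rw [mul_zero, mul_one] at hscale
  rw [phiTr, ← PhiCDF_zero, hdiff, ← hscale]
  simp_rw [gauss, intervalIntegral.integral_const_mul, mul_pow, ← neg_mul]
  rw [mul_left_comm]

lemma hasDerivAt_PsiFn (σ s : ℝ) :
    HasDerivAt (PsiFn σ) ((Real.sqrt (2 * Real.pi))⁻¹ *
      ∫ y in (0:ℝ)..1, -s * y ^ 2 * Real.exp (-s ^ 2 * y ^ 2 / 2) / (1 + σ ^ 2 * y ^ 2)) s := by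
  have hpos (y : ℝ) : 0 < 1 + σ ^ 2 * y ^ 2 := by positivity
  have hcont (x : ℝ) : Continuous fun y : ℝ =>
      Real.exp (-x ^ 2 * y ^ 2 / 2) / (1 + σ ^ 2 * y ^ 2) := by
    fun_prop (disch := intro y; exact (hpos y).ne')
  have hcont' (x : ℝ) : Continuous fun y : ℝ =>
      -x * y ^ 2 * Real.exp (-x ^ 2 * y ^ 2 / 2) / (1 + σ ^ 2 * y ^ 2) := by
    fun_prop (disch := intro y; exact (hpos y).ne')
  refine HasDerivAt.const_mul _ (intervalIntegral.hasDerivAt_integral_of_dominated_loc_of_deriv_le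
    (μ := volume) (bound := fun _ => |s| + 1)
    (F' := fun x y => -x * y ^ 2 * Real.exp (-x ^ 2 * y ^ 2 / 2) / (1 + σ ^ 2 * y ^ 2))
    (Metric.ball_mem_nhds s one_pos)
    (.of_forall fun x => (hcont x).aestronglyMeasurable) ((hcont s).intervalIntegrable 0 1)
    (hcont' s).aestronglyMeasurable ?_
    intervalIntegrable_const ?_).2
  · refine .of_forall fun y hy x hx => ?_
    rw [Set.uIoc_of_le zero_le_one] at hy
    have hx' : |x| ≤ |s| + 1 := by
      have := abs_sub_abs_le_abs_sub x s
      rw [Metric.mem_ball, Real.dist_eq] at hx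
      linarith
    have hy2 : y ^ 2 ≤ 1 := pow_le_one₀ hy.1.le hy.2
    have he : Real.exp (-x ^ 2 * y ^ 2 / 2) ≤ 1 := by
      rw [Real.exp_le_one_iff]
      nlinarith [mul_nonneg (sq_nonneg x) (sq_nonneg y)]
    rw [Real.norm_eq_abs, abs_div, abs_mul, abs_mul, abs_neg, abs_of_pos (hpos y),
      abs_of_nonneg (sq_nonneg y), Real.abs_exp]
    calc |x| * y ^ 2 * Real.exp (-x ^ 2 * y ^ 2 / 2) / (1 + σ ^ 2 * y ^ 2)
        ≤ |x| * y ^ 2 * Real.exp (-x ^ 2 * y ^ 2 / 2) :=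
          div_le_self (by positivity) (by nlinarith [mul_nonneg (sq_nonneg σ) (sq_nonneg y)])
      _ ≤ |x| * 1 * 1 := by gcongr
      _ ≤ |s| + 1 := by simpa using hx'
  · refine .of_forall fun y _ x _ => ?_
    have hexp : HasDerivAt (fun x : ℝ => -x ^ 2 * y ^ 2 / 2) (-x * y ^ 2) x := by
      have := (((hasDerivAt_id x).fun_pow 2).neg.mul_const (y ^ 2)).div_const 2
      convert! this using 1
      simp
      ring
    convert! hexp.exp.div_const (1 + σ ^ 2 * y ^ 2) using 1
    ring

lemma continuous_PsiFn (σ : ℝ) : Continuous (PsiFn σ) :=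
  continuous_iff_continuousAt.2 fun s => (hasDerivAt_PsiFn σ s).continuousAt

lemma abs_PsiFn_le (σ s : ℝ) : |PsiFn σ s| ≤ (Real.sqrt (2 * Real.pi))⁻¹ := by
  rw [PsiFn, abs_mul, abs_of_nonneg (by positivity)]
  refine mul_le_of_le_one_right (by positivity) ?_
  have := intervalIntegral.norm_integral_le_of_norm_le_const (a := 0) (b := 1) (C := 1)
    (f := fun y => Real.exp (-s ^ 2 * y ^ 2 / 2) / (1 + σ ^ 2 * y ^ 2)) fun y _ => ?_
  · simpa using this
  have hpos : 0 < 1 + σ ^ 2 * y ^ 2 := by positivity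
  rw [Real.norm_of_nonneg (by positivity), div_le_one hpos]
  calc Real.exp (-s ^ 2 * y ^ 2 / 2) ≤ 1 := by
        rw [Real.exp_le_one_iff]
        nlinarith [mul_nonneg (sq_nonneg s) (sq_nonneg y)]
    _ ≤ 1 + σ ^ 2 * y ^ 2 := by nlinarith [mul_nonneg (sq_nonneg σ) (sq_nonneg y)]

/-- The function `PsiFn σ` solves the Stein equation `s Ψ - σ² Ψ' = φ`. -/
lemma phiTr_stein (σ s : ℝ) :
    phiTr s = s * PsiFn σ s - σ ^ 2 * ((Real.sqrt (2 * Real.pi))⁻¹ *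
      ∫ y in (0:ℝ)..1, -s * y ^ 2 * Real.exp (-s ^ 2 * y ^ 2 / 2) / (1 + σ ^ 2 * y ^ 2)) := by
  have hpos (y : ℝ) : 0 < 1 + σ ^ 2 * y ^ 2 := by positivity
  have hcont : Continuous fun y : ℝ =>
      Real.exp (-s ^ 2 * y ^ 2 / 2) / (1 + σ ^ 2 * y ^ 2) := by
    fun_prop (disch := intro y; exact (hpos y).ne')
  have hcont' : Continuous fun y : ℝ =>
      -s * y ^ 2 * Real.exp (-s ^ 2 * y ^ 2 / 2) / (1 + σ ^ 2 * y ^ 2) := by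
    fun_prop (disch := intro y; exact (hpos y).ne')
  rw [phiTr_eq_integral, PsiFn, mul_left_comm s, mul_left_comm (σ ^ 2), ← mul_sub,
    ← intervalIntegral.integral_const_mul s, ← intervalIntegral.integral_const_mul (σ ^ 2),
    ← intervalIntegral.integral_sub ((hcont.const_mul s).intervalIntegrable 0 1)
      ((hcont'.const_mul (σ ^ 2)).intervalIntegrable 0 1)]
  congr 1
  refine intervalIntegral.integral_congr fun y _ => ?_
  have := (hpos y).ne'
  field_simp
  ring

lemma integrable_gaussianReal_iff {v : NNReal} (hv : v ≠ 0) {f : ℝ → ℝ} :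
    Integrable f (gaussianReal 0 v) ↔ Integrable fun x => gaussianPDFReal 0 v x * f x := by
  rw [gaussianReal_of_var_ne_zero _ hv, integrable_withDensity_iff_integrable_smul'
    (measurable_gaussianPDF 0 v) (.of_forall fun _ => gaussianPDF_lt_top)]
  simp

lemma hasDerivAt_gaussianPDFReal (v : NNReal) (x : ℝ) :
    HasDerivAt (gaussianPDFReal 0 v) (-(x / v) * gaussianPDFReal 0 v x) x := by
  have hexp : HasDerivAt (fun x : ℝ => -(x - 0) ^ 2 / (2 * v)) (-(x / v)) x := by
    convert! ((((hasDerivAt_id x).sub_const 0).fun_pow 2).neg).div_const (2 * (v : ℝ)) using 1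
    simp
    ring
  convert! hexp.exp.const_mul (Real.sqrt (2 * Real.pi * v))⁻¹ using 1
  rw [gaussianPDFReal]
  ring

/-- One-dimensional integration by parts for `phiTr` against a centered Gaussian. -/
lemma integral_phiTr_mul_gaussianReal {σ : ℝ} {v : NNReal} (hσ : σ ≠ 0) (hv : (v : ℝ) = σ ^ 2)
    {g g' : ℝ → ℝ} (hg : ∀ x, HasDerivAt g (g' x) x)
    (h_phi : Integrable (fun x => phiTr x * g x) (gaussianReal 0 v))
    (h_Psi : Integrable (fun x => PsiFn σ x * g x) (gaussianReal 0 v))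
    (h_Psi' : Integrable (fun x => PsiFn σ x * g' x) (gaussianReal 0 v)) :
    ∫ x, phiTr x * g x ∂(gaussianReal 0 v) = σ ^ 2 * ∫ x, PsiFn σ x * g' x ∂(gaussianReal 0 v) := by
  have hv0 : v ≠ 0 := by
    rw [← NNReal.coe_ne_zero, hv]
    positivity
  rw [integrable_gaussianReal_iff hv0] at h_phi h_Psi h_Psi'
  have hderiv (x : ℝ) : HasDerivAt (fun x => σ ^ 2 * (PsiFn σ x * gaussianPDFReal 0 v x))
      (-(phiTr x * gaussianPDFReal 0 v x)) x := by
    convert! ((hasDerivAt_PsiFn σ x).mul (hasDerivAt_gaussianPDFReal v x)).const_mul (σ ^ 2) using 1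
    rw [phiTr_stein σ x, hv]
    field_simp
    ring
  have key := integral_mul_deriv_eq_deriv_mul_of_integrable (fun x _ => hg x)
    (fun x _ => hderiv x) (h_phi.neg.congr (.of_forall fun x => ?_))
    ((h_Psi'.const_mul (σ ^ 2)).congr (.of_forall fun x => ?_))
    ((h_Psi.const_mul (σ ^ 2)).congr (.of_forall fun x => ?_))
  · rw [integral_gaussianReal_eq_integral_smul hv0, integral_gaussianReal_eq_integral_smul hv0,
      ← integral_const_mul]
    rw [← neg_inj, ← integral_neg, ← integral_neg]
    rw [← integral_neg] at key
    convert! key using 3 <;> simp only [smul_eq_mul] <;> ring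
  all_goals
    simp only [Pi.mul_apply, Pi.neg_apply]
    ring

section JointLaw

variable {Ω ι : Type*} {mΩ : MeasurableSpace Ω} {P : Measure Ω} [Fintype ι]
  {B : Ω → ℝ} {G : ι → Ω → ℝ}

lemma hasGaussianLaw_prod_pi_of_map_eq_gaussianReal [IsProbabilityMeasure P]
    (hGauss : ∀ (c : ℝ) (d : ι → ℝ), ∃ v : NNReal,
      P.map (fun ω => c * B ω + ∑ i, d i * G i ω) = gaussianReal 0 v) :
    HasGaussianLaw (fun ω => (B ω, fun i => G i ω)) P := by
  classical
  have hae (c : ℝ) (d : ι → ℝ) : AEMeasurable (fun ω => c * B ω + ∑ i, d i * G i ω) P := by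
    obtain ⟨v, hv⟩ := hGauss c d
    exact AEMeasurable.of_map_ne_zero (hv ▸ IsProbabilityMeasure.ne_zero _)
  have hB : AEMeasurable B P := by simpa using hae 1 0
  have hG (i : ι) : AEMeasurable (G i) P := by
    simpa [Pi.single_apply] using hae 0 (Pi.single i 1)
  have hpair : AEMeasurable (fun ω => (B ω, fun i => G i ω)) P :=
    hB.prodMk (aemeasurable_pi_lambda _ hG)
  refine ⟨isGaussian_of_map_eq_gaussianReal fun L => ?_⟩
  obtain ⟨v, hv⟩ := hGauss (L (1, 0)) fun i => L (0, Pi.single i 1)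
  refine ⟨0, v, ?_⟩
  rw [AEMeasurable.map_map_of_aemeasurable (by fun_prop) hpair, ← hv]
  congr 1
  ext ω
  have hdecomp : ((B ω, fun i => G i ω) : ℝ × (ι → ℝ)) =
      B ω • ((1 : ℝ), (0 : ι → ℝ)) + ∑ i, G i ω • ((0 : ℝ), (Pi.single i 1 : ι → ℝ)) := by
    ext j
    · simp [Prod.fst_sum]
    · simp [Prod.snd_sum, Finset.sum_apply, Pi.single_apply]
  rw [Function.comp_apply, hdecomp, map_add, map_sum]
  simp_rw [map_smul, smul_eq_mul, mul_comm (L _)]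

/-- Subtracting from a jointly Gaussian vector its regression on `B` makes it independent of `B`. -/
lemma indepFun_sub_regression [IsProbabilityMeasure P]
    (hlaw : HasGaussianLaw (fun ω => (B ω, fun i => G i ω)) P) (hB0 : ∫ ω, B ω ∂P = 0)
    {c : ι → ℝ} (hc : ∀ i, c i * ∫ ω, B ω ^ 2 ∂P = ∫ ω, B ω * G i ω ∂P) :
    IndepFun B (fun ω => (fun i => G i ω) - B ω • c) P := by
  have hB : MemLp B 2 P := hlaw.fst.memLp_two
  have hG (i : ι) : MemLp (G i) 2 P := (hlaw.snd.eval i).memLp_two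
  let L : ℝ × (ι → ℝ) →L[ℝ] (Unit → ℝ) × (ι → ℝ) :=
    (ContinuousLinearMap.pi fun _ => ContinuousLinearMap.fst ℝ ℝ (ι → ℝ)).prod
      (ContinuousLinearMap.snd ℝ ℝ (ι → ℝ) - (ContinuousLinearMap.fst ℝ ℝ (ι → ℝ)).smulRight c)
  have hL : HasGaussianLaw
      (fun ω => ((fun _ : Unit => B ω), fun i => G i ω - B ω * c i)) P := hlaw.map L
  have hindep := HasGaussianLaw.indepFun_of_covariance_eval
    (X := fun _ : Unit => B) (Y := fun i ω => G i ω - B ω * c i) hL fun _ i => by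
      rw [covariance_fun_sub_right hB (hG i) (hB.mul_const (c i)), covariance_mul_const_right,
        covariance_eq_sub hB (hG i), covariance_eq_sub hB hB, hB0]
      have := hc i
      simp only [Pi.mul_apply, ← sq]
      linarith
  exact hindep.comp (measurable_pi_apply ()) measurable_id

end JointLaw

lemma exists_bound_mul_exp {E F : Type*} [NormedAddCommGroup E] [NormedAddCommGroup F]
    {f : E → F} (hf : Continuous f) {a : ℝ}
    (hlim : Filter.Tendsto (fun x => ‖f x‖ * Real.exp (-a * ‖x‖ ^ 2))
      (Filter.cocompact E) (nhds 0)) :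
    ∃ C, ∀ x, ‖f x‖ ≤ C * Real.exp (a * ‖x‖ ^ 2) := by
  obtain ⟨K, hK, hKc⟩ := Filter.mem_cocompact.1 (hlim.eventually_le_const one_pos)
  have hcont : Continuous fun x => ‖f x‖ * Real.exp (-a * ‖x‖ ^ 2) := by fun_prop
  obtain ⟨C, hC⟩ := hK.exists_bound_of_continuousOn hcont.continuousOn
  refine ⟨max C 1, fun x => ?_⟩
  have hx : ‖f x‖ * Real.exp (-a * ‖x‖ ^ 2) ≤ max C 1 := by
    by_cases hxK : x ∈ K
    · exact (Real.le_norm_self _).trans ((hC x hxK).trans (le_max_left _ _))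
    · exact (hKc hxK).trans (le_max_right _ _)
  rwa [neg_mul, Real.exp_neg, ← div_eq_mul_inv, div_le_iff₀ (Real.exp_pos _)] at hx

lemma integrable_mul_comp_of_le_exp {Ω E : Type*} {mΩ : MeasurableSpace Ω} {P : Measure Ω}
    [NormedAddCommGroup E] [MeasurableSpace E] [BorelSpace E]
    {B : Ω → ℝ} {X : Ω → E} (hB : AEMeasurable B P) (hX : AEMeasurable X P) {a : ℝ}
    (hexp : Integrable (fun ω => Real.exp (a * ‖X ω‖ ^ 2)) P)
    {w : ℝ → ℝ} (hw : Measurable w) {K : ℝ} (hK : ∀ s, |w s| ≤ K)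
    {f : E → ℝ} (hf : Continuous f) {C : ℝ} (hC : ∀ x, |f x| ≤ C * Real.exp (a * ‖x‖ ^ 2)) :
    Integrable (fun ω => w (B ω) * f (X ω)) P := by
  refine ((hexp.const_mul C).const_mul K).mono'
    ((hw.comp_aemeasurable hB).mul (hf.measurable.comp_aemeasurable hX)).aestronglyMeasurable
    (.of_forall fun ω => ?_)
  rw [Real.norm_eq_abs, abs_mul]
  exact mul_le_mul (hK _) (hC _) (abs_nonneg _) ((abs_nonneg _).trans (hK 0))

theorem stmt15 {Ω : Type*} [MeasureSpace Ω] [IsProbabilityMeasure (ℙ : Measure Ω)]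
    {m : ℕ} (B : Ω → ℝ) (G : Fin m → Ω → ℝ) (σ : ℝ) (hσ : σ ∈ Set.Ioc (0:ℝ) 1)
    (hGauss : ∀ (c : ℝ) (d : Fin m → ℝ), ∃ v : NNReal,
      Measure.map (fun ω => c * B ω + ∑ i, d i * G i ω) ℙ = gaussianReal 0 v)
    (hvar : (∫ ω, (B ω) ^ 2) = σ ^ 2)
    (h : (Fin m → ℝ) → ℝ) (hh : ContDiff ℝ (⊤ : ℕ∞) h)
    (hgrowth : ∀ (k : ℕ) (a : ℝ), 0 < a →
      Filter.Tendsto (fun x : Fin m → ℝ => ‖iteratedFDeriv ℝ k h x‖ * Real.exp (-a * ‖x‖ ^ 2))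
        (Filter.cocompact _) (nhds 0)) :
    ∫ ω, phiTr (B ω) * h (fun i => G i ω) =
      ∑ i, (∫ ω, B ω * G i ω) *
        ∫ ω, PsiFn σ (B ω) * fderiv ℝ h (fun j => G j ω) (Pi.single i 1) := by
  set X : Ω → Fin m → ℝ := fun ω i => G i ω
  have hσ0 : σ ≠ 0 := hσ.1.ne'
  have hlaw : HasGaussianLaw (fun ω => (B ω, X ω)) ℙ :=
    hasGaussianLaw_prod_pi_of_map_eq_gaussianReal hGauss
  have hBm : AEMeasurable B ℙ := hlaw.fst.aemeasurable
  have hXm : AEMeasurable X ℙ := hlaw.snd.aemeasurable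
  obtain ⟨v, hBv⟩ : ∃ v : NNReal, Measure.map B ℙ = gaussianReal 0 v := by
    simpa using hGauss 1 0
  have hB0 : ∫ ω, B ω = 0 := by
    have := integral_map (f := fun x : ℝ => x) hBm (by fun_prop)
    rw [← this, hBv, integral_id_gaussianReal]
  have hv : (v : ℝ) = σ ^ 2 := by
    rw [← hvar, ← variance_of_integral_eq_zero hBm hB0, ← Function.id_comp B,
      ← variance_map aemeasurable_id hBm, hBv, variance_id_gaussianReal]
  set c : Fin m → ℝ := fun i => (∫ ω, B ω * G i ω) / σ ^ 2 with hc
  have hcσ (i : Fin m) : c i * σ ^ 2 = ∫ ω, B ω * G i ω := by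
    simp only [hc]
    field_simp
  set R : Ω → Fin m → ℝ := fun ω => X ω - B ω • c with hR
  have hRm : AEMeasurable R ℙ := hXm.sub (hBm.smul_const c)
  have hprod : Measure.map (fun ω => (B ω, R ω)) ℙ =
      (gaussianReal 0 v).prod (Measure.map R ℙ) := by
    rw [← hBv]
    exact (indepFun_iff_map_prod_eq_prod_map_map hBm hRm).1
      (indepFun_sub_regression hlaw hB0 fun i => hvar ▸ hcσ i)
  have : IsProbabilityMeasure (Measure.map R ℙ) := Measure.isProbabilityMeasure_map hRm
  have hint {w : ℝ → ℝ} (hw : Measurable w) {f : (Fin m → ℝ) → ℝ} (hf : Continuous f) :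
      AEStronglyMeasurable (fun p : ℝ × (Fin m → ℝ) => w p.1 * f (p.2 + p.1 • c))
        (Measure.map (fun ω => (B ω, R ω)) ℙ) := by
    have : Measurable fun p : ℝ × (Fin m → ℝ) => w p.1 * f (p.2 + p.1 • c) :=
      (hw.comp measurable_fst).mul (hf.measurable.comp (by fun_prop))
    exact this.aestronglyMeasurable
  have hpair : AEMeasurable (fun ω => (B ω, R ω)) ℙ := hBm.prodMk hRm
  have h_disint {w : ℝ → ℝ} (hw : Measurable w) {f : (Fin m → ℝ) → ℝ} (hf : Continuous f)
      (hwf : Integrable (fun ω => w (B ω) * f (X ω))) :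
      (∀ᵐ r ∂(Measure.map R ℙ), Integrable (fun b => w b * f (r + b • c)) (gaussianReal 0 v)) ∧
      ∫ ω, w (B ω) * f (X ω) =
        ∫ r, ∫ b, w b * f (r + b • c) ∂(gaussianReal 0 v) ∂(Measure.map R ℙ) := by
    have hwf' : Integrable (fun p : ℝ × (Fin m → ℝ) => w p.1 * f (p.2 + p.1 • c))
        ((gaussianReal 0 v).prod (Measure.map R ℙ)) := by
      rw [← hprod, integrable_map_measure (hint hw hf) hpair]
      simpa [Function.comp_def, hR] using hwf
    refine ⟨hwf'.prod_left_ae, ?_⟩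
    rw [← integral_prod_symm _ hwf', ← hprod, integral_map hpair (hint hw hf)]
    simp [hR]
  obtain ⟨a, ha, hexp⟩ := (hlaw.snd.isGaussian_map).exists_integrable_exp_sq
  rw [integrable_map_measure (by fun_prop) hXm] at hexp
  have hh' : Continuous (fderiv ℝ h) := hh.continuous_fderiv (by simp)
  obtain ⟨C, hC⟩ := exists_bound_mul_exp hh.continuous (a := a) (by simpa using hgrowth 0 a ha)
  obtain ⟨C', hC'⟩ := exists_bound_mul_exp hh' (a := a)
    (by simpa only [norm_iteratedFDeriv_one] using hgrowth 1 a ha)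
  have hdir (z : Fin m → ℝ) : Continuous fun x => fderiv ℝ h x z := by fun_prop
  have hΨ' (z : Fin m → ℝ) : Integrable (fun ω => PsiFn σ (B ω) * fderiv ℝ h (X ω) z) :=
    integrable_mul_comp_of_le_exp (f := fun x => fderiv ℝ h x z) (C := C' * ‖z‖) hBm hXm hexp
      (continuous_PsiFn σ).measurable (abs_PsiFn_le σ) (hdir z) fun x => by
        calc |fderiv ℝ h x z| ≤ ‖fderiv ℝ h x‖ * ‖z‖ := (fderiv ℝ h x).le_opNorm z
          _ ≤ C' * Real.exp (a * ‖x‖ ^ 2) * ‖z‖ := by gcongr; exact hC' x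
          _ = _ := by ring
  obtain ⟨hφae, hφeq⟩ := h_disint measurable_phiTr hh.continuous
    (integrable_mul_comp_of_le_exp hBm hXm hexp measurable_phiTr abs_phiTr_le hh.continuous hC)
  obtain ⟨hΨae, -⟩ := h_disint (continuous_PsiFn σ).measurable hh.continuous
    (integrable_mul_comp_of_le_exp hBm hXm hexp (continuous_PsiFn σ).measurable
      (abs_PsiFn_le σ) hh.continuous hC)
  obtain ⟨hΨ'ae, hΨ'eq⟩ := h_disint (continuous_PsiFn σ).measurable (hdir c) (hΨ' c)
  calc ∫ ω, phiTr (B ω) * h (X ω)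
      = ∫ r, σ ^ 2 * ∫ b, PsiFn σ b * fderiv ℝ h (r + b • c) c ∂(gaussianReal 0 v)
          ∂(Measure.map R ℙ) := by
        rw [hφeq]
        refine integral_congr_ae ?_
        filter_upwards [hφae, hΨae, hΨ'ae] with r h1 h2 h3
        refine integral_phiTr_mul_gaussianReal hσ0 hv (fun b => ?_) h1 h2 h3
        have hline : HasDerivAt (fun b : ℝ => r + b • c) c b := by
          simpa using ((hasDerivAt_id b).smul_const c).const_add r
        exact ((hh.differentiable (by simp)) _).hasFDerivAt.comp_hasDerivAt b hline
    _ = σ ^ 2 * ∫ ω, PsiFn σ (B ω) * fderiv ℝ h (X ω) c := by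
        rw [integral_const_mul, hΨ'eq]
    _ = σ ^ 2 * ∫ ω, ∑ i, c i * (PsiFn σ (B ω) * fderiv ℝ h (X ω) (Pi.single i 1)) := by
        congr 2 with ω
        conv_lhs => rw [pi_eq_sum_univ' c, map_sum, Finset.mul_sum]
        refine Finset.sum_congr rfl fun i _ => ?_
        rw [map_smul, smul_eq_mul]
        ring
    _ = _ := by
        rw [integral_finsetSum _ fun i _ => (hΨ' _).const_mul _, Finset.mul_sum]
        refine Finset.sum_congr rfl fun i _ => ?_
        rw [integral_const_mul, ← hcσ i]
        ring
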